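/- arXiv:2102.05794 — 4 statements merged into one kernel-verified Lean document; each statement's English description precedes it below -/
import Mathlib

section
/- Let K be a field and let f, u, v, b₀, b₁ ∈ K[x] be polynomials such that: (i) u divides v² − f in K[x]; (ii) u divides b₀ + b₁·v in K[x]; and (iii) b₀ and b₁ are coprime in K[x]. Then in the polynomial ring K[x,y], the ideal generated by {u, b₀ + b₁·y, y² − f} is equal to the ideal generated by {u, y − v}. -/
open MvPolynomial

/-- The inclusion `K[x] → K[x,y]` sending `x` to the first variable. -/
noncomputable def toXY (K : Type*) [Field K] :
    Polynomial K →ₐ[K] MvPolynomial (Fin 2) K :=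
  Polynomial.aeval (MvPolynomial.X 0)

theorem stmt_3 (K : Type*) [Field K] (f u v b₀ b₁ : Polynomial K)
    (h₁ : u ∣ v ^ 2 - f) (h₂ : u ∣ b₀ + b₁ * v) (h₃ : IsCoprime b₀ b₁) :
    Ideal.span {toXY K u, toXY K b₀ + toXY K b₁ * MvPolynomial.X 1,
        (MvPolynomial.X 1) ^ 2 - toXY K f} =
      Ideal.span {toXY K u, MvPolynomial.X 1 - toXY K v} := by
  obtain ⟨m, hm⟩ := h₁
  obtain ⟨k, hk⟩ := h₂
  obtain ⟨a, c, hac⟩ := h₃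
  replace hm := congrArg (toXY K) hm
  replace hk := congrArg (toXY K) hk
  replace hac := congrArg (toXY K) hac
  simp only [map_add, map_sub, map_mul, map_pow, map_one] at hm hk hac
  apply le_antisymm
  · rw [Ideal.span_le]
    rintro p (rfl | rfl | rfl)
    · exact Ideal.subset_span (by simp)
    · exact Ideal.mem_span_pair.mpr
        ⟨toXY K k, toXY K b₁, by linear_combination -hk⟩
    · exact Ideal.mem_span_pair.mpr
        ⟨toXY K m, X 1 + toXY K v, by linear_combination -hm⟩
  · rw [Ideal.span_le]
    rintro p (rfl | rfl)
    · exact Ideal.subset_span (by simp)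
    · refine Ideal.mem_span_insert.mpr
        ⟨toXY K a * toXY K k * (X 1 - toXY K v) - (toXY K c - toXY K a * toXY K v) * toXY K k,
          (toXY K c - toXY K a * toXY K v) * (toXY K b₀ + toXY K b₁ * X 1),
          Ideal.mul_mem_left _ _ (Ideal.subset_span (by simp)), ?_⟩
      linear_combination (-(X 1 - toXY K v)) * hac +
        (toXY K a * (X 1 - toXY K v) - (toXY K c - toXY K a * toXY K v)) * hk
end

section
/- Let R be a commutative ring and let m, n, r ∈ R. In the polynomial ring R[x], set f₃ = x³ + (mx+n)², b₀ = x³ + (2m² + 3mr + 3r²)x² + (m⁴ + 3m³r + 3m²r² + mr³ + mn − 3nr)x + (m³n + 3m²nr + 3mnr² + nr³ + 2n²), b₁ = −(m + 3r)x − (m³ + 3m²r + 3mr² + r³) + 2n, and u = x² + (m² − r²)x + 2n(m + r). Then b₀² − b₁²·f₃ = u³ in R[x]. -/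
open Polynomial

theorem stmt_5 (R : Type*) [CommRing R] (m n r : R)
    (f₃ b₀ b₁ u : R[X])
    (hf₃ : f₃ = X ^ 3 + (C m * X + C n) ^ 2)
    (hb₀ : b₀ = X ^ 3 + C (2 * m ^ 2 + 3 * m * r + 3 * r ^ 2) * X ^ 2 +
        C (m ^ 4 + 3 * m ^ 3 * r + 3 * m ^ 2 * r ^ 2 + m * r ^ 3 + m * n - 3 * n * r) * X +
        C (m ^ 3 * n + 3 * m ^ 2 * n * r + 3 * m * n * r ^ 2 + n * r ^ 3 + 2 * n ^ 2))
    (hb₁ : b₁ = -(C (m + 3 * r)) * X -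
        C (m ^ 3 + 3 * m ^ 2 * r + 3 * m * r ^ 2 + r ^ 3) + C (2 * n))
    (hu : u = X ^ 2 + C (m ^ 2 - r ^ 2) * X + C (2 * n * (m + r))) :
    b₀ ^ 2 - b₁ ^ 2 * f₃ = u ^ 3 := by
  subst hf₃ hb₀ hb₁ hu
  simp only [map_add, map_sub, map_mul, map_pow, map_ofNat]
  ring
end

section
/- Let K = ℂ(t) be the field of rational functions in one variable over ℂ (RatFunc ℂ). In the polynomial ring K[x,y], set f₅ = x³ + ¼(t² + 4t − 4)x² + ½t(t − 1)x + ¼(t − 1)² and v = (t − 1)/2, and set g₁ = (−t − 2)x² + 2xy + (−2t + 1)x + 2y + (1 − t), g₂ = −4x³ + (−t² − 4t + 4)x² + (−2t² + 2t)x + 4y² − t² + 2t − 1, g₃ = 2x⁴ − 2x³ + 2x² + tx + t − 2y − 1. Then the ideal of K[x,y] generated by {x⁵, x⁴(y − v), x³(y − v)², x²(y − v)³, x(y − v)⁴, (y − v)⁵, y² − f₅} is equal to the ideal generated by {g₁, g₂, g₃}. -/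
open MvPolynomial

noncomputable abbrev K9 := RatFunc ℂ
noncomputable abbrev tm : MvPolynomial (Fin 2) K9 := C RatFunc.X
noncomputable abbrev xm : MvPolynomial (Fin 2) K9 := MvPolynomial.X 0
noncomputable abbrev ym : MvPolynomial (Fin 2) K9 := MvPolynomial.X 1

/-- `f₅ = x³ + ¼(t² + 4t − 4)x² + ½t(t − 1)x + ¼(t − 1)²` in `K[x,y]`. -/
noncomputable def f₅₉ : MvPolynomial (Fin 2) K9 :=
  xm ^ 3 + C (1 / 4 : K9) * (tm ^ 2 + 4 * tm - 4) * xm ^ 2 +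
    C (1 / 2 : K9) * tm * (tm - 1) * xm + C (1 / 4 : K9) * (tm - 1) ^ 2

/-- `v = (t − 1)/2` regarded as a constant of `K[x,y]`. -/
noncomputable def v₉ : MvPolynomial (Fin 2) K9 := C ((RatFunc.X - 1) / 2 : K9)

/-- On a curve `(u - x s)(u + x s + w) + x⁵ h = 0` with `w` a unit, the fifth power of the ideal
`(x, u)` cuts out the same ideal as `x⁵` and the local branch `u = x s`. -/
theorem span_fifth_power_eq_span_branch {R : Type*} [CommRing R] {x u s w w' h f : R}
    (hw : w * w' = 1) (hf : f = (u - x * s) * (u + x * s + w) + x ^ 5 * h) :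
    Ideal.span {x ^ 5, x ^ 4 * u, x ^ 3 * u ^ 2, x ^ 2 * u ^ 3, x * u ^ 4, u ^ 5, f} =
      Ideal.span {x ^ 5, u - x * s} := by
  apply le_antisymm <;> rw [Ideal.span_le]
  · set I := Ideal.span {x ^ 5, u - x * s}
    have hx : Ideal.Quotient.mk I x ^ 5 = 0 := by
      rw [← map_pow, Ideal.Quotient.eq_zero_iff_mem]
      exact Ideal.subset_span (by simp)
    have hu : Ideal.Quotient.mk I u = Ideal.Quotient.mk I x * Ideal.Quotient.mk I s := by
      rw [← map_mul, Ideal.Quotient.eq]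
      exact Ideal.subset_span (by simp)
    rintro a (rfl | rfl | rfl | rfl | rfl | rfl | rfl) <;>
      rw [SetLike.mem_coe, ← Ideal.Quotient.eq_zero_iff_mem] <;>
      simp only [hf, map_add, map_sub, map_mul, map_pow, hu]
    · exact hx
    · linear_combination Ideal.Quotient.mk I s * hx
    · linear_combination Ideal.Quotient.mk I s ^ 2 * hx
    · linear_combination Ideal.Quotient.mk I s ^ 3 * hx
    · linear_combination Ideal.Quotient.mk I s ^ 4 * hx
    · linear_combination Ideal.Quotient.mk I s ^ 5 * hx
    · linear_combination Ideal.Quotient.mk I h * hx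
  · set J := Ideal.span {x ^ 5, x ^ 4 * u, x ^ 3 * u ^ 2, x ^ 2 * u ^ 3, x * u ^ 4, u ^ 5, f}
    have h₀ : x ^ 5 ∈ J := Ideal.subset_span (by simp)
    have h₁ : x ^ 4 * u ∈ J := Ideal.subset_span (by simp)
    have h₂ : x ^ 3 * u ^ 2 ∈ J := Ideal.subset_span (by simp)
    have h₃ : x ^ 2 * u ^ 3 ∈ J := Ideal.subset_span (by simp)
    have h₄ : x * u ^ 4 ∈ J := Ideal.subset_span (by simp)
    have h₅ : u ^ 5 ∈ J := Ideal.subset_span (by simp)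
    have h_f : f ∈ J := Ideal.subset_span (by simp)
    have h_pow : (u + x * s) ^ 5 ∈ J := by
      have e : (u + x * s) ^ 5 = s ^ 5 * x ^ 5 + 5 * s ^ 4 * (x ^ 4 * u) +
          10 * s ^ 3 * (x ^ 3 * u ^ 2) + 10 * s ^ 2 * (x ^ 2 * u ^ 3) +
          5 * s * (x * u ^ 4) + u ^ 5 := by ring
      rw [e]
      exact J.add_mem (J.add_mem (J.add_mem (J.add_mem (J.add_mem (J.mul_mem_left _ h₀)
        (J.mul_mem_left _ h₁)) (J.mul_mem_left _ h₂)) (J.mul_mem_left _ h₃))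
        (J.mul_mem_left _ h₄)) h₅
    have h_prod : (u - x * s) * (u + x * s + w) ∈ J := by
      have e : (u - x * s) * (u + x * s + w) = f - h * x ^ 5 := by rw [hf]; ring
      rw [e]
      exact J.sub_mem h_f (J.mul_mem_left _ h₀)
    have h_branch : u - x * s ∈ J := by
      have hw5 : w ^ 5 * w' ^ 5 = 1 := by rw [← mul_pow, hw, one_pow]
      have e : u - x * s = w' ^ 5 * (w ^ 4 - w ^ 3 * (u + x * s) + w ^ 2 * (u + x * s) ^ 2 -
            w * (u + x * s) ^ 3 + (u + x * s) ^ 4) * ((u - x * s) * (u + x * s + w)) -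
          w' ^ 5 * (u - x * s) * (u + x * s) ^ 5 := by
        linear_combination -(u - x * s) * hw5
      rw [e]
      exact J.sub_mem (J.mul_mem_left _ h_prod) (J.mul_mem_left _ h_pow)
    rintro a (rfl | rfl)
    exacts [h₀, h_branch]

theorem stmt_9 :
    Ideal.span {xm ^ 5, xm ^ 4 * (ym - v₉), xm ^ 3 * (ym - v₉) ^ 2,
        xm ^ 2 * (ym - v₉) ^ 3, xm * (ym - v₉) ^ 4, (ym - v₉) ^ 5, ym ^ 2 - f₅₉} =
      Ideal.span
        {(-tm - 2) * xm ^ 2 + 2 * xm * ym + (-2 * tm + 1) * xm + 2 * ym + (1 - tm),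
          -4 * xm ^ 3 + (-tm ^ 2 - 4 * tm + 4) * xm ^ 2 + (-2 * tm ^ 2 + 2 * tm) * xm +
            4 * ym ^ 2 - tm ^ 2 + 2 * tm - 1,
          2 * xm ^ 4 - 2 * xm ^ 3 + 2 * xm ^ 2 + tm * xm + tm - 2 * ym - 1} := by
  have hc : (2 : MvPolynomial (Fin 2) K9) * C (1 / 2) = 1 := by
    rw [← map_ofNat C 2, ← C_mul, ← C_1]
    norm_num
  have hc' : C (1 / 4 : K9) = (C (1 / 2) ^ 2 : MvPolynomial (Fin 2) K9) := by
    rw [← C_pow]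
    norm_num
  have hv : v₉ = C (1 / 2) * (tm - 1) := by
    rw [v₉, tm, ← C_1, ← C_sub, ← C_mul]
    ring_nf
  have ht : (RatFunc.X - 1 : K9) ≠ 0 := by
    rw [← RatFunc.algebraMap_X, ← map_one (algebraMap (Polynomial ℂ) K9), ← map_sub]
    exact RatFunc.algebraMap_ne_zero (Polynomial.X_sub_C_ne_zero (1 : ℂ))
  have hw : (tm - 1) * C (RatFunc.X - 1 : K9)⁻¹ = 1 := by
    rw [tm, ← C_1, ← C_sub, ← C_mul, mul_inv_cancel₀ ht]
  have hf : ym ^ 2 - f₅₉ =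
      (ym - v₉ - xm * (xm ^ 3 - xm ^ 2 + xm + C (1 / 2) * tm)) *
        (ym - v₉ + xm * (xm ^ 3 - xm ^ 2 + xm + C (1 / 2) * tm) + (tm - 1)) +
      xm ^ 5 * (xm ^ 3 - 2 * xm ^ 2 + 3 * xm + (tm - 2)) := by
    rw [f₅₉, hv, hc']
    generalize (C (1 / 2) : MvPolynomial (Fin 2) K9) = c at hc
    grind
  rw [span_fifth_power_eq_span_branch hw hf]
  rw [f₅₉, hc'] at hf
  rw [hv] at hf ⊢
  generalize (C (1 / 2) : MvPolynomial (Fin 2) K9) = c at hc hf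
  apply le_antisymm <;> rw [Ideal.span_le]
  · rintro a (rfl | rfl) <;> rw [SetLike.mem_coe, Ideal.mem_span_insert]
    · refine ⟨c, c * (xm + 1) * (2 * xm ^ 4 - 2 * xm ^ 3 + 2 * xm ^ 2 + tm * xm + tm - 2 * ym - 1),
        Ideal.mul_mem_left _ _ (Ideal.subset_span (by simp)), ?_⟩
      linear_combination -xm ^ 5 * hc
    · refine ⟨0, -c * (2 * xm ^ 4 - 2 * xm ^ 3 + 2 * xm ^ 2 + tm * xm + tm - 2 * ym - 1),
        Ideal.mul_mem_left _ _ (Ideal.subset_span (by simp)), ?_⟩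
      linear_combination -(ym - xm ^ 4 + xm ^ 3 - xm ^ 2) * hc
  · rintro a (rfl | rfl | rfl) <;> rw [SetLike.mem_coe, Ideal.mem_span_pair]
    · refine ⟨2, 2 * (xm + 1), ?_⟩
      linear_combination -(xm + 1) * (tm * xm + tm - 1) * hc
    · refine ⟨4 * (xm ^ 3 - 2 * xm ^ 2 + 3 * xm + (tm - 2)), 4 * (ym - c * (tm - 1) +
        xm * (xm ^ 3 - xm ^ 2 + xm + c * tm) + (tm - 1)), ?_⟩
      grind
    · refine ⟨0, -2, ?_⟩
      linear_combination (tm * xm + tm - 1) * hc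
end

section
/- For every r ∈ ℂ there exist homogeneous polynomials H₁ of degree 8 and H₃ of degree 6 in ℂ[T,X,Z] such that H₁² − H₃²·F₅ = 4Z·h₂⁵, where F₅ = X³Z + ¼(T² + 4TZ − 4Z²)X² + ½T(T − Z)XZ + ¼(T − Z)²Z² is the degree-4 homogenization of f₅(t,x) = x³ + ¼(t²+4t−4)x² + ½t(t−1)x + ¼(t−1)², and h₂ = −4r²XZ² + 4rTZ² − 4rZ³ + T²X + 2T²Z + 4TXZ − 2TZ² + 4X²Z − 4XZ². In particular, for distinct values of r the cubics h₂ are distinct, so the plane curve B : Z⁴·F₅ = 0 satisfies infinitely many quasi-toric relations of type (2,5,2). -/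
open MvPolynomial

noncomputable abbrev Tv : MvPolynomial (Fin 3) ℂ := MvPolynomial.X 0
noncomputable abbrev Xv : MvPolynomial (Fin 3) ℂ := MvPolynomial.X 1
noncomputable abbrev Zv : MvPolynomial (Fin 3) ℂ := MvPolynomial.X 2

/-- The degree-4 homogenization `F₅` of `f₅(t,x)`. -/
noncomputable def F₅ : MvPolynomial (Fin 3) ℂ :=
  Xv ^ 3 * Zv + C (1 / 4 : ℂ) * (Tv ^ 2 + 4 * Tv * Zv - 4 * Zv ^ 2) * Xv ^ 2 +
    C (1 / 2 : ℂ) * Tv * (Tv - Zv) * Xv * Zv + C (1 / 4 : ℂ) * (Tv - Zv) ^ 2 * Zv ^ 2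

/-- The cubic `h₂` of Example 3.3. -/
noncomputable def h₂₅ (r : ℂ) : MvPolynomial (Fin 3) ℂ :=
  -(C (4 * r ^ 2)) * Xv * Zv ^ 2 + C (4 * r) * Tv * Zv ^ 2 - C (4 * r) * Zv ^ 3 +
    Tv ^ 2 * Xv + 2 * Tv ^ 2 * Zv + 4 * Tv * Xv * Zv - 2 * Tv * Zv ^ 2 +
    4 * Xv ^ 2 * Zv - 4 * Xv * Zv ^ 2

/-- Multiplication by a variable reflects homogeneity. -/
theorem MvPolynomial.IsHomogeneous.of_X_mul {σ R : Type*} [CommSemiring R] {i : σ}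
    {p : MvPolynomial σ R} {n : ℕ} (hp : (X i * p).IsHomogeneous (n + 1)) :
    p.IsHomogeneous n := by
  intro d hd
  have h := hp (d := Finsupp.single i 1 + d) (by rwa [coeff_X_mul])
  rw [map_add, Finsupp.weight_single] at h
  simp only [Pi.one_apply, smul_eq_mul, mul_one] at h
  omega

theorem isHomogeneous_C_mul_Tv_Xv_Zv (c : ℂ) (i j k : ℕ) :
    (C c * Tv ^ i * Xv ^ j * Zv ^ k).IsHomogeneous (i + j + k) := by
  simpa using (((isHomogeneous_C _ c).mul (isHomogeneous_X_pow 0 i)).mul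
    (isHomogeneous_X_pow 1 j)).mul (isHomogeneous_X_pow 2 k)

theorem isHomogeneous_h₂₅ (r : ℂ) : (h₂₅ r).IsHomogeneous 3 := by
  have key := isHomogeneous_C_mul_Tv_Xv_Zv
  have e : h₂₅ r = C (-(4 * r ^ 2) - 4) * Tv ^ 0 * Xv ^ 1 * Zv ^ 2
      + C (4 * r - 2) * Tv ^ 1 * Xv ^ 0 * Zv ^ 2 + C (-(4 * r)) * Tv ^ 0 * Xv ^ 0 * Zv ^ 3
      + C 1 * Tv ^ 2 * Xv ^ 1 * Zv ^ 0 + C 2 * Tv ^ 2 * Xv ^ 0 * Zv ^ 1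
      + C 4 * Tv ^ 1 * Xv ^ 1 * Zv ^ 1 + C 4 * Tv ^ 0 * Xv ^ 2 * Zv ^ 1 := by
    simp only [h₂₅, map_sub, map_neg, map_mul, map_pow, map_one, map_ofNat]
    ring
  rw [e]
  exact ((((((key _ 0 1 2).add (key _ 1 0 2)).add (key _ 0 0 3)).add (key _ 2 1 0)).add
    (key _ 2 0 1)).add (key _ 1 1 1)).add (key _ 0 2 1)

/-- Twice the polynomial `r x - (t - 1) / 2` of the Mumford representation, homogenized. -/
noncomputable def mumfordV (r : ℂ) : MvPolynomial (Fin 3) ℂ :=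
  Zv * (C (2 * r) * Xv - (Tv - Zv))

theorem isHomogeneous_mumfordV (r : ℂ) : (mumfordV r).IsHomogeneous 2 :=
  (isHomogeneous_X ℂ 2).mul ((isHomogeneous_C_mul_X (2 * r) 1).sub
    ((isHomogeneous_X ℂ 0).sub (isHomogeneous_X ℂ 2)))

theorem four_mul_F₅ (r : ℂ) : 4 * F₅ = mumfordV r ^ 2 + Xv * h₂₅ r := by
  have h4 : (4 : MvPolynomial (Fin 3) ℂ) * C (1 / 4) = 1 := by
    rw [← map_ofNat C 4, ← C_mul]; norm_num
  have h2 : (4 : MvPolynomial (Fin 3) ℂ) * C (1 / 2) = 2 := by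
    rw [← map_ofNat C 4, ← C_mul, ← map_ofNat C 2]; norm_num
  simp only [F₅, mumfordV, h₂₅, map_mul, map_pow, map_ofNat]
  linear_combination ((Tv ^ 2 + 4 * Tv * Zv - 4 * Zv ^ 2) * Xv ^ 2 + (Tv - Zv) ^ 2 * Zv ^ 2) * h4
    + Tv * (Tv - Zv) * Xv * Zv * h2

/-- The coefficients of `y` in the functions obtained, by repeatedly multiplying with `y + v` and
dividing by `x`, from one whose divisor is five times a torsion point minus the point at infinity;
that each division is exact is the recurrence. -/
theorem exists_recurrence (r : ℂ) : ∃ q : ℕ → MvPolynomial (Fin 3) ℂ,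
    q 0 = Xv + Zv ∧ q 1 = Xv * (Tv + 2 * Zv + C (2 * r) * Zv) + Zv * (Tv + C (2 * r) * Zv) ∧
      ∀ i < 4, Xv * q (i + 2) = 2 * mumfordV r * q (i + 1) + h₂₅ r * q i := by
  let s : MvPolynomial (Fin 3) ℂ := C (2 * r)
  let X := Xv
  let Z := Zv
  let W := Tv + s * Zv
  let U := Tv - Zv
  let q₂ := W ^ 2 * Z + (W ^ 2 + 4 * W * Z) * X + 4 * Z * X ^ 2
  let q₃ := W ^ 3 * Z + (W ^ 3 + 6 * W ^ 2 * Z) * X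
    + (4 * W * Z + 8 * Z ^ 2 + 8 * s * Z ^ 2) * X ^ 2
  let q₄ := W ^ 4 * Z + (W ^ 4 + 8 * W ^ 3 * Z + 16 * U ^ 2 * Z ^ 2) * X
    + (8 * W ^ 2 * Z + 32 * W * Z ^ 2 - 16 * Z ^ 3 + 16 * s ^ 2 * Z ^ 3) * X ^ 2
    + 16 * Z ^ 2 * X ^ 3
  let q₅ := (W ^ 5 * Z - 32 * U ^ 3 * Z ^ 3)
    + (W ^ 5 + 10 * W ^ 4 * Z + 16 * W ^ 3 * Z ^ 2 - 64 * W ^ 2 * Z ^ 3 + 80 * W * Z ^ 4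
      - 32 * Z ^ 5 + 32 * s * W ^ 2 * Z ^ 3 - 32 * s * W * Z ^ 4 - 112 * s ^ 2 * W * Z ^ 4
      + 96 * s ^ 2 * Z ^ 5 + 64 * s ^ 3 * Z ^ 5) * X
    + (8 * W ^ 3 * Z + 48 * W ^ 2 * Z ^ 2 - 16 * W * Z ^ 3 + 16 * s * W ^ 2 * Z ^ 2
      + 64 * s * W * Z ^ 3 - 64 * s * Z ^ 4 - 16 * s ^ 2 * W * Z ^ 3 - 32 * s ^ 2 * Z ^ 4
      + 32 * s ^ 3 * Z ^ 4) * X ^ 2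
    + (16 * W * Z ^ 2 + 32 * Z ^ 3 + 64 * s * Z ^ 3) * X ^ 3
  refine ⟨fun i => match i with
    | 0 => Xv + Zv
    | 1 => Xv * (Tv + 2 * Zv + C (2 * r) * Zv) + Zv * (Tv + C (2 * r) * Zv)
    | 2 => q₂
    | 3 => q₃
    | 4 => q₄
    | _ => q₅, rfl, rfl, fun i hi => ?_⟩
  interval_cases i <;>
  · simp only [q₂, q₃, q₄, q₅, W, U, X, Z, s, h₂₅, mumfordV, map_mul, map_pow, map_ofNat]
    ring

theorem exists_quasiToric (r : ℂ) : ∃ H₁ H₃ : MvPolynomial (Fin 3) ℂ,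
    H₁.IsHomogeneous 8 ∧ H₃.IsHomogeneous 6 ∧
      H₁ ^ 2 - H₃ ^ 2 * F₅ = 4 * Zv * h₂₅ r ^ 5 := by
  obtain ⟨q, hq0, hq1, hq⟩ := exists_recurrence r
  have hV := isHomogeneous_mumfordV r
  have hh := isHomogeneous_h₂₅ r
  have two {p : MvPolynomial (Fin 3) ℂ} {n : ℕ} (hp : p.IsHomogeneous n) :
      (2 * p).IsHomogeneous n := by
    rw [← map_ofNat C 2]; exact hp.C_mul 2
  have hT := isHomogeneous_X ℂ (0 : Fin 3)
  have hX := isHomogeneous_X ℂ (1 : Fin 3)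
  have hZ := isHomogeneous_X ℂ (2 : Fin 3)
  have hom0 : (q 0).IsHomogeneous 1 := hq0 ▸ hX.add hZ
  have hom1 : (q 1).IsHomogeneous 2 := hq1 ▸
    (hX.mul ((hT.add (two hZ)).add (hZ.C_mul _))).add (hZ.mul (hT.add (hZ.C_mul _)))
  have step (i : ℕ) (hi : i < 4) (h0 : (q i).IsHomogeneous (i + 1))
      (h1 : (q (i + 1)).IsHomogeneous (i + 2)) : (q (i + 2)).IsHomogeneous (i + 3) := by
    refine .of_X_mul (i := 1) ?_
    rw [hq i hi]
    have a := (two hV).mul h1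
    have b := hh.mul h0
    rw [show 2 + (i + 2) = i + 3 + 1 by omega] at a
    rw [show 3 + (i + 1) = i + 3 + 1 by omega] at b
    exact a.add b
  have hom2 := step 0 (by norm_num) hom0 hom1
  have hom3 := step 1 (by norm_num) hom1 hom2
  have hom4 := step 2 (by norm_num) hom2 hom3
  have hom5 := step 3 (by norm_num) hom3 hom4
  have r2 := hq 0 (by norm_num)
  have r3 := hq 1 (by norm_num)
  have r4 := hq 2 (by norm_num)
  have r5 := hq 3 (by norm_num)
  simp only [Nat.reduceAdd] at r2 r3 r4 r5 hom4 hom5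
  have hX0 : Xv ≠ 0 := X_ne_zero 1
  have d1 : q 1 ^ 2 - q 0 * q 2 = -(4 * Zv * Xv ^ 3) := by
    apply mul_left_cancel₀ hX0
    have : Xv * (q 1 ^ 2 - q 0 * q 2)
        = Xv * q 1 ^ 2 - q 0 * (2 * mumfordV r * q 1 + h₂₅ r * q 0) := by
      linear_combination -q 0 * r2
    rw [this, hq0, hq1]
    simp only [h₂₅, mumfordV, map_mul, map_pow, map_ofNat]
    ring
  have d4 : q 4 ^ 2 - q 3 * q 5 = 4 * Zv * h₂₅ r ^ 3 := by
    apply mul_left_cancel₀ (pow_ne_zero 3 hX0)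
    have e2 : Xv * (q 2 ^ 2 - q 1 * q 3) = -h₂₅ r * (q 1 ^ 2 - q 0 * q 2) := by
      linear_combination q 2 * r2 - q 1 * r3
    have e3 : Xv * (q 3 ^ 2 - q 2 * q 4) = -h₂₅ r * (q 2 ^ 2 - q 1 * q 3) := by
      linear_combination q 3 * r3 - q 2 * r4
    have e4 : Xv * (q 4 ^ 2 - q 3 * q 5) = -h₂₅ r * (q 3 ^ 2 - q 2 * q 4) := by
      linear_combination q 4 * r4 - q 3 * r5
    linear_combination Xv ^ 2 * e4 - Xv * h₂₅ r * e3 + h₂₅ r ^ 2 * e2 - h₂₅ r ^ 3 * d1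
  refine ⟨mumfordV r * q 5 + h₂₅ r * q 4, 2 * q 5, (hV.mul hom5).add (hh.mul hom4),
    two hom5, ?_⟩
  linear_combination -q 5 ^ 2 * four_mul_F₅ r - h₂₅ r * q 5 * r5 + h₂₅ r ^ 2 * d4

theorem h₂₅_injective : Function.Injective h₂₅ := by
  intro r r' h
  have := congrArg (MvPolynomial.eval ![0, 0, 1]) h
  simpa [h₂₅] using this

theorem stmt_10 :
    (∀ r : ℂ, ∃ H₁ H₃ : MvPolynomial (Fin 3) ℂ,
        H₁.IsHomogeneous 8 ∧ H₃.IsHomogeneous 6 ∧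
          H₁ ^ 2 - H₃ ^ 2 * F₅ = 4 * Zv * h₂₅ r ^ 5) ∧
      Function.Injective h₂₅ :=
  ⟨exists_quasiToric, h₂₅_injective⟩
end
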